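/- arXiv:0808.1522 — 4 statements merged into one kernel-verified Lean document; each statement's English description precedes it below -/
import Mathlib

section
/- Let ν be a Borel probability measure on ℝ and b > 0 a real number with ν((0,b)) = 1. Then the supremum, over all finite partitions 0 = s₀ < s₁ < ⋯ < sₙ = b of [0,b], of the lower sums ∑_{i<n} sᵢ · ν((sᵢ, sᵢ₊₁)) is equal to the infimum, over all such partitions, of the upper sums ∑_{i<n} sᵢ₊₁ · ν([sᵢ, sᵢ₊₁]). In particular the pair of cuts determined by these lower and upper sums defines a single (Dedekind) real number. -/
open MeasureTheory

section PartitionSums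

variable {s : ℕ → ℝ} {n : ℕ}

lemma partition_nonneg (h0 : s 0 = 0) (hs : ∀ i < n, s i < s (i + 1)) : ∀ i ≤ n, 0 ≤ s i
  | 0, _ => h0.ge
  | i + 1, hi => (partition_nonneg h0 hs i (by omega)).trans (hs i (by omega)).le

variable (ν : Measure ℝ) [IsFiniteMeasure ν]

lemma sum_integral_partition {f : ℝ → ℝ} (hf : Continuous f) (hs : ∀ i < n, s i < s (i + 1)) :
    ∑ i ∈ Finset.range n, ∫ x in Set.Ioc (s i) (s (i + 1)), f x ∂ν =
      ∫ x in (s 0)..(s n), f x ∂ν := by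
  rw [← intervalIntegral.sum_integral_adjacent_intervals
    (fun i _ => hf.intervalIntegrable (s i) (s (i + 1)))]
  refine Finset.sum_congr rfl fun i hi => ?_
  rw [intervalIntegral.integral_of_le (hs i (Finset.mem_range.1 hi)).le]

lemma lowerSum_le_integral (h0 : s 0 = 0) (hs : ∀ i < n, s i < s (i + 1)) :
    ∑ i ∈ Finset.range n, s i * (ν (Set.Ioo (s i) (s (i + 1)))).toReal ≤
      ∫ x in (s 0)..(s n), x ∂ν := by
  rw [← sum_integral_partition ν continuous_id' hs]
  refine Finset.sum_le_sum fun i hi => ?_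
  have hi' := Finset.mem_range.1 hi
  calc s i * (ν (Set.Ioo (s i) (s (i + 1)))).toReal
      ≤ s i * ν.real (Set.Ioc (s i) (s (i + 1))) :=
        mul_le_mul_of_nonneg_left (measureReal_mono Set.Ioo_subset_Ioc_self)
          (partition_nonneg h0 hs i hi'.le)
    _ = ∫ _ in Set.Ioc (s i) (s (i + 1)), s i ∂ν := by
        rw [setIntegral_const, smul_eq_mul, mul_comm]
    _ ≤ ∫ x in Set.Ioc (s i) (s (i + 1)), x ∂ν :=
        setIntegral_mono_on (integrable_const _) (continuous_id'.integrableOn_Ioc)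
          measurableSet_Ioc fun x hx => hx.1.le

lemma integral_le_upperSum (h0 : s 0 = 0) (hs : ∀ i < n, s i < s (i + 1)) :
    ∫ x in (s 0)..(s n), x ∂ν ≤
      ∑ i ∈ Finset.range n, s (i + 1) * (ν (Set.Icc (s i) (s (i + 1)))).toReal := by
  rw [← sum_integral_partition ν continuous_id' hs]
  refine Finset.sum_le_sum fun i hi => ?_
  have hi' := Finset.mem_range.1 hi
  calc ∫ x in Set.Ioc (s i) (s (i + 1)), x ∂ν
      ≤ ∫ _ in Set.Ioc (s i) (s (i + 1)), s (i + 1) ∂ν :=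
        setIntegral_mono_on (continuous_id'.integrableOn_Ioc) (integrable_const _)
          measurableSet_Ioc fun x hx => hx.2
    _ = s (i + 1) * ν.real (Set.Ioc (s i) (s (i + 1))) := by
        rw [setIntegral_const, smul_eq_mul, mul_comm]
    _ ≤ s (i + 1) * (ν (Set.Icc (s i) (s (i + 1)))).toReal :=
        mul_le_mul_of_nonneg_left (measureReal_mono Set.Ioc_subset_Icc_self)
          (partition_nonneg h0 hs (i + 1) hi')

lemma upperSum_le_lowerSum_add {δ : ℝ} (hs : ∀ i < n, s i < s (i + 1))
    (hmesh : ∀ i < n, s (i + 1) ≤ s i + δ) (hδ : 0 ≤ δ) (hatom : ∀ i, ν {s i} = 0) :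
    ∑ i ∈ Finset.range n, s (i + 1) * (ν (Set.Icc (s i) (s (i + 1)))).toReal ≤
      ∑ i ∈ Finset.range n, s i * (ν (Set.Ioo (s i) (s (i + 1)))).toReal +
        δ * ν.real Set.univ := by
  have htotal : ∑ i ∈ Finset.range n, ν.real (Set.Ioc (s i) (s (i + 1))) ≤ ν.real Set.univ := by
    have h := sum_integral_partition ν (continuous_const (y := (1 : ℝ))) hs
    simp only [setIntegral_const, smul_eq_mul, mul_one, intervalIntegral.integral_const',
      measureReal_def] at h
    simp only [measureReal_def]
    rw [h]
    exact (sub_le_self _ ENNReal.toReal_nonneg).trans (measureReal_mono (Set.subset_univ _))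
  refine le_trans ?_ (add_le_add_right (mul_le_mul_of_nonneg_left htotal hδ) _)
  rw [Finset.mul_sum, ← Finset.sum_add_distrib]
  refine Finset.sum_le_sum fun i hi => ?_
  rw [← measure_congr (Ioo_ae_eq_Icc' (hatom i) (hatom (i + 1))),
    measureReal_def, ← measure_congr (Ioo_ae_eq_Ioc' (hatom (i + 1))), ← add_mul]
  exact mul_le_mul_of_nonneg_right (hmesh i (Finset.mem_range.1 hi)) ENNReal.toReal_nonneg

lemma exists_measure_singleton_eq_zero {a c : ℝ} (hac : a < c) :
    ∃ x, a ≤ x ∧ x < c ∧ ν {x} = 0 := by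
  have hcount : {x : ℝ | 0 < ν {x}}.Countable :=
    Measure.countable_meas_pos_of_disjoint_iUnion (fun x => measurableSet_singleton x)
      fun x y hxy => Set.disjoint_singleton.2 hxy
  obtain ⟨x, hx, hax, hxc⟩ := hcount.dense_compl ℝ |>.exists_between hac
  exact ⟨x, hax.le, hxc, by simpa using hx⟩

lemma exists_partition_upperSum_sub_lowerSum_lt {b ε : ℝ} (hb : 0 < b) (hε : 0 < ε)
    (hν0 : ν {0} = 0) (hνb : ν {b} = 0) :
    ∃ (n : ℕ) (s : ℕ → ℝ), 0 < n ∧ s 0 = 0 ∧ s n = b ∧ (∀ i < n, s i < s (i + 1)) ∧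
      ∑ i ∈ Finset.range n, s (i + 1) * (ν (Set.Icc (s i) (s (i + 1)))).toReal <
        ∑ i ∈ Finset.range n, s i * (ν (Set.Ioo (s i) (s (i + 1)))).toReal + ε := by
  obtain ⟨N, hN⟩ := exists_nat_gt (2 * b * ν.real Set.univ / ε)
  have hN0 : (0 : ℝ) < N := lt_of_le_of_lt (by positivity) hN
  have hNpos : 0 < N := by exact_mod_cast hN0
  have hh : 0 < b / N := by positivity
  have hNh : N * (b / N) = b := by field_simp
  have hpt : ∀ i : ℕ, ∃ x : ℝ, i * (b / N) ≤ x ∧ x < (i + 1) * (b / N) ∧ ν {x} = 0 ∧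
      (i = 0 → x = 0) ∧ (i = N → x = b) := by
    intro i
    by_cases hi0 : i = 0
    · subst hi0
      exact ⟨0, by simp, by simpa using hh, hν0, fun _ => rfl, by omega⟩
    by_cases hiN : i = N
    · subst hiN
      exact ⟨b, hNh.le, by linarith, hνb, by omega, fun _ => rfl⟩
    obtain ⟨x, h1, h2, h3⟩ := exists_measure_singleton_eq_zero ν
      (show (i : ℝ) * (b / N) < (i + 1) * (b / N) by linarith)
    exact ⟨x, h1, h2, h3, fun h => absurd h hi0, fun h => absurd h hiN⟩
  choose s hlo hhi hatom hzero hend using hpt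
  have hs : ∀ i < N, s i < s (i + 1) := fun i _ =>
    (hhi i).trans_le (by simpa using hlo (i + 1))
  refine ⟨N, s, hNpos, hzero 0 rfl, hend N rfl, hs, ?_⟩
  refine (upperSum_le_lowerSum_add ν (δ := 2 * (b / N)) hs (fun i _ => ?_) (by positivity)
    hatom).trans_lt ?_
  · have h1 := hlo i
    have h2 := hhi (i + 1)
    push_cast at h2
    linarith
  · rw [div_lt_iff₀ hε] at hN
    have : 2 * (b / N) * ν.real Set.univ < ε := by
      rw [show 2 * (b / N) * ν.real Set.univ = 2 * b * ν.real Set.univ / N by ring,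
        div_lt_iff₀ hN0]
      linarith
    linarith

end PartitionSums

/-- For a Borel probability measure `ν` on `ℝ` with `ν ((0, b)) = 1`,
`b > 0`, the supremum over all finite partitions `0 = s₀ < s₁ < ⋯ < sₙ = b` of the
lower sums `∑_{i<n} sᵢ · ν ((sᵢ, sᵢ₊₁))` equals the infimum over all such
partitions of the upper sums `∑_{i<n} sᵢ₊₁ · ν ([sᵢ, sᵢ₊₁])`. -/
theorem lowerSums_sup_eq_upperSums_inf
    (ν : Measure ℝ) [IsProbabilityMeasure ν] (b : ℝ) (hb : 0 < b)
    (hν : ν (Set.Ioo 0 b) = 1) :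
    sSup {x : ℝ | ∃ (n : ℕ) (s : ℕ → ℝ), 0 < n ∧ s 0 = 0 ∧ s n = b ∧
        (∀ i < n, s i < s (i + 1)) ∧
        x = ∑ i ∈ Finset.range n, s i * (ν (Set.Ioo (s i) (s (i + 1)))).toReal} =
    sInf {x : ℝ | ∃ (n : ℕ) (s : ℕ → ℝ), 0 < n ∧ s 0 = 0 ∧ s n = b ∧
        (∀ i < n, s i < s (i + 1)) ∧
        x = ∑ i ∈ Finset.range n, s (i + 1) * (ν (Set.Icc (s i) (s (i + 1)))).toReal} := by
  have hnull : ν (Set.Ioo 0 b)ᶜ = 0 := (prob_compl_eq_zero_iff measurableSet_Ioo).2 hν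
  have hν0 : ν {0} = 0 := measure_mono_null (by simp) hnull
  have hνb : ν {b} = 0 := measure_mono_null (by simp) hnull
  have happrox := fun ε (hε : 0 < ε) =>
    exists_partition_upperSum_sub_lowerSum_lt ν hb hε hν0 hνb
  trans ∫ x in 0..b, x ∂ν
  · refine csSup_eq_of_forall_le_of_forall_lt_exists_gt ?_ ?_ ?_
    · obtain ⟨n, s, hn, h0, hnb, hs, -⟩ := happrox 1 one_pos
      exact ⟨_, n, s, hn, h0, hnb, hs, rfl⟩
    · rintro _ ⟨n, s, hn, h0, hnb, hs, rfl⟩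
      simpa only [h0, hnb] using lowerSum_le_integral ν h0 hs
    · intro w hw
      obtain ⟨n, s, hn, h0, hnb, hs, hlt⟩ := happrox _ (sub_pos.2 hw)
      refine ⟨_, ⟨n, s, hn, h0, hnb, hs, rfl⟩, ?_⟩
      have hle := integral_le_upperSum ν h0 hs
      rw [h0, hnb] at hle
      linarith
  · symm
    refine csInf_eq_of_forall_ge_of_forall_gt_exists_lt ?_ ?_ ?_
    · obtain ⟨n, s, hn, h0, hnb, hs, -⟩ := happrox 1 one_pos
      exact ⟨_, n, s, hn, h0, hnb, hs, rfl⟩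
    · rintro _ ⟨n, s, hn, h0, hnb, hs, rfl⟩
      simpa only [h0, hnb] using integral_le_upperSum ν h0 hs
    · intro w hw
      obtain ⟨n, s, hn, h0, hnb, hs, hlt⟩ := happrox _ (sub_pos.2 hw)
      refine ⟨_, ⟨n, s, hn, h0, hnb, hs, rfl⟩, ?_⟩
      have hle := lowerSum_le_integral ν h0 hs
      rw [h0, hnb] at hle
      linarith
end

section
/- Let X be a compact Hausdorff space and let I : C(X, ℝ) → ℝ be a positive linear functional. For f ∈ C(X, ℝ) with f ≥ 0 define μ_I(f) := sup over n ∈ ℕ of I(n•f ⊓ 1), where ⊓ is the pointwise minimum and 1 the constant function one (this supremum exists since the sequence is nondecreasing and bounded above by I(1)). Then for all f, g ∈ C(X, ℝ) with f ≥ 0 and g ≥ 0: μ_I(f) + μ_I(g) = μ_I(f ⊓ g) + μ_I(f ⊔ g). -/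
section PositiveFunctional

variable {X : Type*} [TopologicalSpace X]

theorem ContinuousMap.nsmul_inf_one_add_nsmul_inf_one (f g : C(X, ℝ)) (n : ℕ) :
    (n • f ⊓ 1) + (n • g ⊓ 1) = (n • (f ⊓ g) ⊓ 1) + (n • (f ⊔ g) ⊓ 1) := by
  ext x
  simp only [ContinuousMap.add_apply, ContinuousMap.inf_apply, ContinuousMap.sup_apply,
    ContinuousMap.smul_apply, ContinuousMap.one_apply]
  rcases le_total (f x) (g x) with h | h
  · rw [inf_eq_left.2 h, sup_eq_right.2 h]
  · rw [inf_eq_right.2 h, sup_eq_left.2 h, add_comm]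

theorem LinearMap.tendsto_nsmul_inf_one_iSup (I : C(X, ℝ) →ₗ[ℝ] ℝ)
    (hI : ∀ f : C(X, ℝ), 0 ≤ f → 0 ≤ I f) {f : C(X, ℝ)} (hf : 0 ≤ f) :
    Filter.Tendsto (fun n : ℕ => I (n • f ⊓ 1)) Filter.atTop
      (nhds (⨆ n : ℕ, I (n • f ⊓ 1))) := by
  have hmono : Monotone I := fun a b hab => by
    simpa using hI (b - a) (sub_nonneg.2 hab)
  refine tendsto_atTop_ciSup (fun m n hmn => hmono ?_)
    ⟨I 1, Set.forall_mem_range.2 fun n => hmono inf_le_right⟩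
  exact inf_le_inf_right 1 (nsmul_le_nsmul_left hf hmn)

end PositiveFunctional

/-- modular law for `μ_I`: let `X` be compact Hausdorff and
`I : C(X, ℝ) → ℝ` a positive linear functional. With
`μ_I(f) = ⨆ n, I (n • f ⊓ 1)` for `f ≥ 0`, one has
`μ_I(f) + μ_I(g) = μ_I(f ⊓ g) + μ_I(f ⊔ g)` for all `f, g ≥ 0`. -/
theorem muI_modular
    {X : Type*} [TopologicalSpace X] [CompactSpace X] [T2Space X]
    (I : C(X, ℝ) →ₗ[ℝ] ℝ) (hI : ∀ f : C(X, ℝ), 0 ≤ f → 0 ≤ I f)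
    (f g : C(X, ℝ)) (hf : 0 ≤ f) (hg : 0 ≤ g) :
    (⨆ n : ℕ, I (n • f ⊓ 1)) + (⨆ n : ℕ, I (n • g ⊓ 1)) =
      (⨆ n : ℕ, I (n • (f ⊓ g) ⊓ 1)) + (⨆ n : ℕ, I (n • (f ⊔ g) ⊓ 1)) := by
  have h := (I.tendsto_nsmul_inf_one_iSup hI hf).add (I.tendsto_nsmul_inf_one_iSup hI hg)
  refine tendsto_nhds_unique h (((I.tendsto_nsmul_inf_one_iSup hI (le_inf hf hg)).add
    (I.tendsto_nsmul_inf_one_iSup hI (hf.trans le_sup_left))).congr fun n => ?_)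
  rw [← map_add, ← map_add, ContinuousMap.nsmul_inf_one_add_nsmul_inf_one f g]
end

section
/- Let ι be a finite index set, let A : ι → Set α be a family of subsets of a type α, and let n be the cardinality of ι. Then, as functions from α to ℕ, ∑_{i ∈ ι} 1_{A_i} = ∑_{k = 1}^{n} 1_{B_k}, where B_k = ⋃_{K ⊆ ι, |K| = k} ⋂_{i ∈ K} A_i. Equivalently, for every x ∈ α the number of indices i with x ∈ A_i equals the number of k ∈ {1, …, n} such that x lies in at least k of the sets A_i. -/
open Classical in
/-- A point lies in some `k`-fold intersection of a finite family iff it lies in at least `k`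
members of the family. -/
theorem mem_iUnion_card_eq_iInter_iff {α ι : Type*} [Fintype ι] (A : ι → Set α) (k : ℕ) (x : α) :
    (x ∈ ⋃ (K : Finset ι) (_ : K.card = k), ⋂ i ∈ K, A i) ↔
      k ≤ (Finset.univ.filter fun i => x ∈ A i).card := by
  simp only [Set.mem_iUnion, Set.mem_iInter, exists_prop]
  constructor
  · rintro ⟨K, rfl, hK⟩
    exact Finset.card_le_card fun i hi => by simpa using hK i hi
  · intro h
    obtain ⟨K, hK, hcard⟩ := Finset.exists_subset_card_eq h
    exact ⟨K, hcard, fun i hi => by simpa using hK hi⟩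

/-- Horn–Tarski identity, set-theoretic form: for a finite family
`A : ι → Set α` with `n = |ι|`, as functions `α → ℕ`,
`∑ i, 1_{A i} = ∑ k ∈ {1, …, n}, 1_{B k}` where
`B k = ⋃_{K ⊆ ι, |K| = k} ⋂_{i ∈ K} A i`. -/
theorem sum_indicator_eq_sum_indicator_iUnion_iInter
    {α ι : Type*} [Fintype ι] (A : ι → Set α) :
    (∑ i : ι, (A i).indicator (1 : α → ℕ)) =
      ∑ k ∈ Finset.Icc 1 (Fintype.card ι),
        Set.indicator
          (⋃ (K : Finset ι) (_ : K.card = k), ⋂ i ∈ K, A i) (1 : α → ℕ) := by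
  classical
  ext x
  simp only [Finset.sum_apply, Set.indicator_apply, mem_iUnion_card_eq_iInter_iff, Pi.one_apply,
    ← Finset.card_filter]
  have hle : (Finset.univ.filter fun i => x ∈ A i).card ≤ Fintype.card ι := Finset.card_le_univ _
  generalize (Finset.univ.filter fun i => x ∈ A i).card = m at hle ⊢
  have hfilter : (Finset.Icc 1 (Fintype.card ι)).filter (· ≤ m) = Finset.Icc 1 m := by
    ext k
    simp only [Finset.mem_filter, Finset.mem_Icc]
    omega
  rw [hfilter, Nat.card_Icc, Nat.add_sub_cancel]
end

section
/- Let L be a lattice with top element ⊤ and bottom element ⊥, and let ι, κ, λ be finite index types. For finite families with nonnegative rational coefficients (r : ι → ℚ≥0, a : ι → L), (s : κ → ℚ≥0, b : κ → L), (t : λ → ℚ≥0, c : λ → L), define (r, a) ≤ (s, b) to mean: for every subset I of ι, ⨅_{i ∈ I} a_i ≤ ⨆ { ⨅_{j ∈ J} b_j : J ⊆ κ, ∑_{i∈I} r_i ≤ ∑_{j∈J} s_j } (infima over the empty set being ⊤ and suprema over the empty collection being ⊥, all infima and suprema finite). Then this relation is transitive: (r, a) ≤ (s, b) and (s, b) ≤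 (t, c) imply (r, a) ≤ (t, c). -/
open scoped NNRat

/-- The order on positive simple functions `∑ rᵢ xᵢ` over a bounded lattice `L`:
`(r, a) ≤ (s, b)` iff for every subset `I` of the index set,
`⨅_{i ∈ I} aᵢ ≤ ⨆ { ⨅_{j ∈ J} bⱼ : J, ∑_{i ∈ I} rᵢ ≤ ∑_{j ∈ J} sⱼ }`. -/
def SimpleLE {L : Type*} [Lattice L] [BoundedOrder L]
    {ι κ : Type*} [Fintype ι] [Fintype κ]
    (r : ι → ℚ≥0) (a : ι → L) (s : κ → ℚ≥0) (b : κ → L) : Prop :=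
  ∀ I : Finset ι,
    letI : DecidablePred fun J : Finset κ => ∑ i ∈ I, r i ≤ ∑ j ∈ J, s j :=
      fun _ => Classical.dec _
    I.inf a ≤
      (Finset.univ.filter
          (fun J : Finset κ => ∑ i ∈ I, r i ≤ ∑ j ∈ J, s j)).sup
        (fun J => J.inf b)

/-- the order on positive simple functions over a bounded lattice
is transitive. -/
theorem simpleLE_trans {L : Type*} [Lattice L] [BoundedOrder L]
    {ι κ lam : Type*} [Fintype ι] [Fintype κ] [Fintype lam]
    (r : ι → ℚ≥0) (a : ι → L) (s : κ → ℚ≥0) (b : κ → L)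
    (t : lam → ℚ≥0) (c : lam → L)
    (h₁ : SimpleLE r a s b) (h₂ : SimpleLE s b t c) :
    SimpleLE r a t c := by
  intro I
  refine (h₁ I).trans (Finset.sup_le fun J hJ => (h₂ J).trans (Finset.sup_mono fun K hK => ?_))
  have hr := ((@Finset.mem_filter _ _ (_) _ _).1 hJ).2
  have hs := ((@Finset.mem_filter _ _ (_) _ _).1 hK).2
  exact (@Finset.mem_filter _ _ (_) _ _).2 ⟨Finset.mem_univ K, hr.trans hs⟩
end
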